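/- There exists a constant C > 0 such that for every i ≥ 1 and every k ≥ 1, ‖R_i·R_{i+2}·⋯·R_{i+2k} − (L + (R_i − L)·L)‖_F ≤ C·(exp(∑_{l=1}^{k} ‖R_{i+2l} − L‖_F) − 1). -/

import Mathlib

open Filter Finset Matrix

/-- The golden ratio φ = (1+√5)/2. -/
noncomputable def goldphi : ℝ := (1 + Real.sqrt 5) / 2

/-- The matrix `A`: identity in rows 1–7, row 8 = (0,0,0,0,0,1,1,1,1),
row 9 = (0,0,0,1,1,2,0,1,2). -/
def Amat : Matrix (Fin 9) (Fin 9) ℝ :=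
  !![1,0,0,0,0,0,0,0,0;
     0,1,0,0,0,0,0,0,0;
     0,0,1,0,0,0,0,0,0;
     0,0,0,1,0,0,0,0,0;
     0,0,0,0,1,0,0,0,0;
     0,0,0,0,0,1,0,0,0;
     0,0,0,0,0,0,1,0,0;
     0,0,0,0,0,1,1,1,1;
     0,0,0,1,1,2,0,1,2]

/-- The matrix `M` with rows e₆, e₉, e₈, e₂, e₄+e₅, e₇, e₁+e₃, e₃, e₄. -/
def Mmat : Matrix (Fin 9) (Fin 9) ℝ :=
  !![0,0,0,0,0,1,0,0,0;
     0,0,0,0,0,0,0,0,1;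
     0,0,0,0,0,0,0,1,0;
     0,1,0,0,0,0,0,0,0;
     0,0,0,1,1,0,0,0,0;
     0,0,0,0,0,0,1,0,0;
     1,0,1,0,0,0,0,0,0;
     0,0,1,0,0,0,0,0,0;
     0,0,0,1,0,0,0,0,0]

/-- The rank-one limit matrix `L`, nonzero only in rows 2 and 3. -/
noncomputable def Lmat : Matrix (Fin 9) (Fin 9) ℝ :=
  !![0,0,0,0,0,0,0,0,0;
     (Real.sqrt 5 - 1)/4, 1/2, (1 + Real.sqrt 5)/4, (3 + Real.sqrt 5)/4, 1/2, 0, (3 + Real.sqrt 5)/4, 0, 0;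
     (3 - Real.sqrt 5)/4, (Real.sqrt 5 - 1)/4, 1/2, (1 + Real.sqrt 5)/4, (Real.sqrt 5 - 1)/4, 0, (1 + Real.sqrt 5)/4, 0, 0;
     0,0,0,0,0,0,0,0,0;
     0,0,0,0,0,0,0,0,0;
     0,0,0,0,0,0,0,0,0;
     0,0,0,0,0,0,0,0,0;
     0,0,0,0,0,0,0,0,0;
     0,0,0,0,0,0,0,0,0]

/-- `a_i = r_i - 1`. -/
def aseq (r : ℕ → ℕ) (i : ℕ) : ℕ := r i - 1

/-- `c_i = (2/√5)·φ^{2 a_i}`. -/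
noncomputable def cseq (r : ℕ → ℕ) (i : ℕ) : ℝ :=
  (2 / Real.sqrt 5) * goldphi ^ (2 * aseq r i)

/-- `P_i = A^{a_i} M A^{a_{i+1}} M`. -/
noncomputable def Pmat (r : ℕ → ℕ) (i : ℕ) : Matrix (Fin 9) (Fin 9) ℝ :=
  Amat ^ (aseq r i) * Mmat * Amat ^ (aseq r (i+1)) * Mmat

/-- `R_i = P_i / c_{i+1}`. -/
noncomputable def Rmat (r : ℕ → ℕ) (i : ℕ) : Matrix (Fin 9) (Fin 9) ℝ :=
  (cseq r (i+1))⁻¹ • Pmat r i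

/-- The Frobenius norm of a square real matrix. -/
noncomputable def frobNorm {n : ℕ} (X : Matrix (Fin n) (Fin n) ℝ) : ℝ :=
  Real.sqrt (∑ i, ∑ j, (X i j)^2)

/-- The hypotheses on the sequence `r`: `r 1 = 1`, `r 2 = 2`, and the sequence of
differences `n ↦ r (n+1) - r n` (for `n ≥ 1`) is strictly increasing. -/
def GoodSeq (r : ℕ → ℕ) : Prop :=
  r 1 = 1 ∧ r 2 = 2 ∧ ∀ n, 1 ≤ n → r (n+1) - r n < r (n+2) - r (n+1)


section FrobeniusFacts

attribute [local instance] Matrix.frobeniusNormedRing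

theorem frobNorm_eq_norm {n : ℕ} (X : Matrix (Fin n) (Fin n) ℝ) : frobNorm X = ‖X‖ := by
  rw [Matrix.frobenius_norm_def, frobNorm, Real.sqrt_eq_rpow]
  simp

theorem frobNorm_mul_le {n : ℕ} (X Y : Matrix (Fin n) (Fin n) ℝ) :
    frobNorm (X * Y) ≤ frobNorm X * frobNorm Y := by
  rw [frobNorm_eq_norm, frobNorm_eq_norm, frobNorm_eq_norm]
  exact Matrix.frobenius_norm_mul X Y

theorem frobNorm_add_le {n : ℕ} (X Y : Matrix (Fin n) (Fin n) ℝ) :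
    frobNorm (X + Y) ≤ frobNorm X + frobNorm Y := by
  rw [frobNorm_eq_norm, frobNorm_eq_norm, frobNorm_eq_norm]
  exact norm_add_le X Y

end FrobeniusFacts

theorem frobNorm_nonneg {n : ℕ} (X : Matrix (Fin n) (Fin n) ℝ) : 0 ≤ frobNorm X :=
  Real.sqrt_nonneg _

theorem frobNorm_smul {n : ℕ} (t : ℝ) (ht : 0 ≤ t) (X : Matrix (Fin n) (Fin n) ℝ) :
    frobNorm (t • X) = t * frobNorm X := by
  unfold frobNorm
  have h : (∑ i, ∑ j, ((t • X) i j)^2) = t^2 * ∑ i, ∑ j, (X i j)^2 := by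
    simp only [Matrix.smul_apply, smul_eq_mul, mul_pow, Finset.mul_sum]
  rw [h, Real.sqrt_mul (sq_nonneg t), Real.sqrt_sq ht]

theorem frobNorm_zero {n : ℕ} : frobNorm (0 : Matrix (Fin n) (Fin n) ℝ) = 0 := by
  simp [frobNorm]

/-- The abstract product estimate. -/
theorem product_estimate {n : ℕ} (L : Matrix (Fin n) (Fin n) ℝ) (hL : L * L = L)
    (S ρ : ℝ) (hρ : 0 < ρ) :
    ∃ C : ℝ, 0 < C ∧ ∀ R : ℕ → Matrix (Fin n) (Fin n) ℝ, frobNorm (R 0) ≤ ρ →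
      (∀ k, ∑ l ∈ Finset.Icc 1 k, frobNorm (R l - L) ≤ S) → ∀ k,
      frobNorm (((List.range (k+1)).map R).prod - (L + (R 0 - L) * L))
        ≤ C * (Real.exp (∑ l ∈ Finset.Icc 1 k, frobNorm (R l - L)) - 1)
          + (if k = 0 then frobNorm (R 0 - R 0 * L) else 0) := by
  obtain ⟨lam, hlam1, hlam⟩ : ∃ lam : ℝ, 1 ≤ lam ∧ frobNorm L ≤ lam :=
    ⟨max 1 (frobNorm L), le_max_left _ _, le_max_right _ _⟩
  have hlam0 : 0 < lam := by linarith
  set B : ℝ := lam * ρ * Real.exp (lam * S) with hB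
  have hBpos : 0 < B := by positivity
  refine ⟨B * lam, by positivity, ?_⟩
  intro R hR0 hS k
  set T : ℕ → Matrix (Fin n) (Fin n) ℝ := fun k => ((List.range (k+1)).map R).prod with hT
  have hT0 : T 0 = R 0 := by simp [hT]
  have hTs : ∀ k, T (k+1) = T k * R (k+1) := by
    intro k
    simp only [hT]
    rw [List.range_succ, List.map_append, List.prod_append]
    simp
  set σ : ℕ → ℝ := fun k => ∑ l ∈ Finset.Icc 1 k, frobNorm (R l - L) with hσ
  have hσ0 : σ 0 = 0 := by simp [hσ]
  have hσs : ∀ k, σ (k+1) = σ k + frobNorm (R (k+1) - L) := by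
    intro k
    simp only [hσ]
    rw [Finset.sum_Icc_succ_top (by omega)]
  have hσnn : ∀ k, 0 ≤ σ k := fun k => Finset.sum_nonneg fun _ _ => frobNorm_nonneg _
  have hstep : ∀ k, T (k+1) = T k * L + T k * (R (k+1) - L) := by
    intro k
    rw [hTs, ← Matrix.mul_add]; congr 1; abel
  have hstepL : ∀ k, T (k+1) * L = T k * L + T k * (R (k+1) - L) * L := by
    intro k
    rw [hstep, Matrix.add_mul, Matrix.mul_assoc (T k) L L, hL]
  have hbd : ∀ k, frobNorm (T k) ≤ lam * ρ * Real.exp (lam * σ k) ∧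
      frobNorm (T k * L) ≤ lam * ρ * Real.exp (lam * σ k) := by
    intro k
    induction k with
    | zero =>
      rw [hT0, hσ0]
      simp only [mul_zero, Real.exp_zero, mul_one]
      constructor
      · nlinarith
      · calc _ ≤ frobNorm (R 0) * frobNorm L := frobNorm_mul_le _ _
          _ ≤ ρ * lam := mul_le_mul hR0 hlam (frobNorm_nonneg _) hρ.le
          _ = _ := mul_comm _ _
    | succ k ih =>
      obtain ⟨ih1, ih2⟩ := ih
      set e := frobNorm (R (k+1) - L) with he
      have he0 : 0 ≤ e := frobNorm_nonneg _
      set h := lam * ρ * Real.exp (lam * σ k) with hh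
      have hh0 : 0 < h := by positivity
      have hgoal : h * (1 + lam * e) ≤ lam * ρ * Real.exp (lam * σ (k+1)) := by
        rw [hσs, mul_add lam, Real.exp_add, ← mul_assoc, ← hh]
        apply mul_le_mul_of_nonneg_left _ hh0.le
        linarith [Real.add_one_le_exp (lam * e)]
      have hTe : frobNorm (T k * (R (k+1) - L)) ≤ h * e :=
        (frobNorm_mul_le _ _).trans (mul_le_mul_of_nonneg_right ih1 he0)
      have hTe0 : 0 ≤ h * e := by positivity
      constructor
      · refine le_trans ?_ hgoal
        rw [hstep]
        refine (frobNorm_add_le _ _).trans ?_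
        nlinarith
      · refine le_trans ?_ hgoal
        rw [hstepL]
        refine (frobNorm_add_le _ _).trans ?_
        have : frobNorm (T k * (R (k+1) - L) * L) ≤ h * e * lam :=
          (frobNorm_mul_le _ _).trans (mul_le_mul hTe hlam (frobNorm_nonneg _) hTe0)
        nlinarith
  have hTB : ∀ k, frobNorm (T k) ≤ B := by
    intro k
    refine (hbd k).1.trans ?_
    rw [hB]
    have := hS k
    gcongr
  have hF : ∀ k, frobNorm (T k * L - R 0 * L) ≤ B * lam * σ k := by
    intro k
    induction k with
    | zero => rw [hT0, sub_self, frobNorm_zero, hσ0, mul_zero]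
    | succ k ih =>
      have e1 : T (k+1) * L - R 0 * L = (T k * L - R 0 * L) + T k * (R (k+1) - L) * L := by
        rw [hstepL]; abel
      rw [e1, hσs]
      refine (frobNorm_add_le _ _).trans ?_
      have he0 : 0 ≤ frobNorm (R (k+1) - L) := frobNorm_nonneg _
      have h1 : frobNorm (T k * (R (k+1) - L)) ≤ B * frobNorm (R (k+1) - L) :=
        (frobNorm_mul_le _ _).trans (mul_le_mul_of_nonneg_right (hTB k) he0)
      have h2 : frobNorm (T k * (R (k+1) - L) * L) ≤ B * frobNorm (R (k+1) - L) * lam :=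
        (frobNorm_mul_le _ _).trans (mul_le_mul h1 hlam (frobNorm_nonneg _) (by positivity))
      linarith
  have hG : L + (R 0 - L) * L = R 0 * L := by
    rw [Matrix.sub_mul, hL]; abel
  change frobNorm (T k - (L + (R 0 - L) * L)) ≤ B * lam * (Real.exp (σ k) - 1) + _
  rw [hG]
  rcases k with _ | k
  · rw [hT0, hσ0]; simp
  · have e1 : T (k+1) - R 0 * L = (T k * L - R 0 * L) + T k * (R (k+1) - L) := by
      rw [hstep]; abel
    rw [e1]
    have he0 : 0 ≤ frobNorm (R (k+1) - L) := frobNorm_nonneg _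
    have h1 : frobNorm (T k * (R (k+1) - L)) ≤ B * frobNorm (R (k+1) - L) :=
      (frobNorm_mul_le _ _).trans (mul_le_mul_of_nonneg_right (hTB k) he0)
    have h2 : B * frobNorm (R (k+1) - L) ≤ B * lam * frobNorm (R (k+1) - L) := by
      apply mul_le_mul_of_nonneg_right _ he0
      nlinarith
    have h3 : B * lam * σ (k+1) ≤ B * lam * (Real.exp (σ (k+1)) - 1) := by
      apply mul_le_mul_of_nonneg_left _ (by positivity)
      linarith [Real.add_one_le_exp (σ (k+1))]
    have h4 := hF k
    have h5 := frobNorm_add_le (T k * L - R 0 * L) (T k * (R (k+1) - L))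
    rw [hσs] at h3
    rw [hσs]
    simp only [Nat.add_eq_zero_iff, one_ne_zero, and_false, if_false]
    linarith

/-- Right eigenvector of `A`, with parameter `s` a square root of `5`. -/
noncomputable def uvec (s : ℝ) : Fin 9 → ℝ := ![0,0,0,0,0,0,0,1,(1+s)/2]

/-- Left eigenvector of `A`, with parameter `s` a square root of `5`. -/
noncomputable def wvec (s : ℝ) : Fin 9 → ℝ :=
  ![0,0,0,(s-1)/2,(s-1)/2,(1+s)/2,(3-s)/2,(s-1)/2,1]

/-- Projection onto the fixed space of `A`. -/
def Eone : Matrix (Fin 9) (Fin 9) ℝ :=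
  !![1,0,0,0,0,0,0,0,0;
     0,1,0,0,0,0,0,0,0;
     0,0,1,0,0,0,0,0,0;
     0,0,0,1,0,0,0,0,0;
     0,0,0,0,1,0,0,0,0;
     0,0,0,0,0,1,0,0,0;
     0,0,0,0,0,0,1,0,0;
     0,0,0,-1,-1,-1,1,0,0;
     0,0,0,0,0,-1,-1,0,0]

theorem Amat_mul_Eone : Amat * Eone = Eone := by
  ext i j
  fin_cases i <;> fin_cases j <;>
    simp [Amat, Eone, Matrix.mul_apply, Fin.sum_univ_succ] <;> norm_num

theorem Amat_mulVec_uvec (s : ℝ) (hs : s * s = 5) :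
    Amat *ᵥ uvec s = ((3 + s)/2) • uvec s := by
  ext i
  fin_cases i <;>
    simp [Amat, uvec, Matrix.mulVec, dotProduct, Fin.sum_univ_succ] <;> linarith

theorem Amat_mul_proj (s : ℝ) (hs : s * s = 5) :
    Amat * vecMulVec (uvec s) (wvec s) = ((3 + s)/2) • vecMulVec (uvec s) (wvec s) := by
  rw [Matrix.mul_vecMulVec, Amat_mulVec_uvec s hs, Matrix.smul_vecMulVec]

theorem proj_sum (s : ℝ) (hs : s * s = 5) :
    Eone + ((s/5) • vecMulVec (uvec s) (wvec s)
      + (-(s/5)) • vecMulVec (uvec (-s)) (wvec (-s))) = 1 := by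
  ext i j
  fin_cases i <;> fin_cases j <;>
    simp [Eone, uvec, wvec, Matrix.vecMulVec_apply, Matrix.one_apply] <;> nlinarith

theorem Amat_pow (s : ℝ) (hs : s * s = 5) (n : ℕ) :
    Amat ^ n = Eone + (((3 + s)/2)^n * (s/5)) • vecMulVec (uvec s) (wvec s)
      + (((3 - s)/2)^n * (-(s/5))) • vecMulVec (uvec (-s)) (wvec (-s)) := by
  induction n with
  | zero =>
    simp only [pow_zero, one_mul]
    rw [← proj_sum s hs, add_assoc]
  | succ n ih =>
    have h2 := Amat_mul_proj (-s) (by linarith)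
    rw [← sub_eq_add_neg] at h2
    rw [pow_succ', ih, Matrix.mul_add, Matrix.mul_add, Amat_mul_Eone, Matrix.mul_smul,
      Matrix.mul_smul, Amat_mul_proj s hs, h2, smul_smul, smul_smul]
    congr 2
    · congr 1; ring
    · ring

theorem Amat_fix (s : ℝ) (n : ℕ) :
    Amat ^ n * (Mmat * vecMulVec (uvec s) (wvec s)) = Mmat * vecMulVec (uvec s) (wvec s) := by
  have h : Amat * (Mmat * vecMulVec (uvec s) (wvec s)) = Mmat * vecMulVec (uvec s) (wvec s) := by
    rw [Matrix.mul_vecMulVec, Matrix.mul_vecMulVec]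
    congr 1
    ext i
    fin_cases i <;>
      simp [Amat, Mmat, uvec, Matrix.mulVec, dotProduct, Fin.sum_univ_succ]
  induction n with
  | zero => simp
  | succ n ih => rw [pow_succ, Matrix.mul_assoc, h, ih]

theorem Lmat_eq :
    Lmat = ((1:ℝ)/2) • (Mmat * vecMulVec (uvec (Real.sqrt 5)) (wvec (Real.sqrt 5)) * Mmat) := by
  have hs : Real.sqrt 5 * Real.sqrt 5 = 5 := Real.mul_self_sqrt (by norm_num)
  have h1 : Mmat *ᵥ uvec (Real.sqrt 5) = ![0, (1 + Real.sqrt 5)/2, 1, 0, 0, 0, 0, 0, 0] := by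
    ext i
    fin_cases i <;> simp [Mmat, uvec, Matrix.mulVec, dotProduct, Fin.sum_univ_succ]
  have h2 : wvec (Real.sqrt 5) ᵥ* Mmat = ![(3 - Real.sqrt 5)/2, (Real.sqrt 5 - 1)/2, 1,
      (1 + Real.sqrt 5)/2, (Real.sqrt 5 - 1)/2, 0, (1 + Real.sqrt 5)/2, 0, 0] := by
    ext i
    fin_cases i <;>
      simp [Mmat, wvec, Matrix.vecMul, dotProduct, Fin.sum_univ_succ] <;> ring
  rw [Matrix.mul_vecMulVec, Matrix.vecMulVec_mul, h1, h2]
  unfold Lmat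
  generalize Real.sqrt 5 = s at *
  ext i j
  fin_cases i <;> fin_cases j <;> simp [Matrix.vecMulVec_apply] <;> nlinarith

theorem Lmat_sq : Lmat * Lmat = Lmat := by
  have hs : Real.sqrt 5 * Real.sqrt 5 = 5 := Real.mul_self_sqrt (by norm_num)
  unfold Lmat
  generalize Real.sqrt 5 = s at *
  ext i j
  fin_cases i <;> fin_cases j <;> simp [Matrix.mul_apply, Fin.sum_univ_succ] <;> nlinarith

theorem goldphi_sq : goldphi ^ 2 = (3 + Real.sqrt 5)/2 := by
  have hs : Real.sqrt 5 * Real.sqrt 5 = 5 := Real.mul_self_sqrt (by norm_num)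
  unfold goldphi
  nlinarith

theorem exists_geom_bound (r : ℕ → ℕ) (hr : GoodSeq r) :
    ∃ K q : ℝ, 0 < K ∧ 0 ≤ q ∧ q < 1 ∧ ∀ i, 1 ≤ i → frobNorm (Rmat r i - Lmat) ≤ K * q ^ i := by
  have hs : Real.sqrt 5 * Real.sqrt 5 = 5 := Real.mul_self_sqrt (by norm_num)
  have hspos : 0 < Real.sqrt 5 := by positivity
  have hgp := goldphi_sq
  have hL := Lmat_eq
  have hs2 : 2 < Real.sqrt 5 := by nlinarith
  have hs3 : Real.sqrt 5 < 3 := by nlinarith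
  have hgap : ∀ i, 1 ≤ i → aseq r i + i ≤ aseq r (i+1) := by
    obtain ⟨h1, h2, h3⟩ := hr
    have hd : ∀ i, 1 ≤ i → i ≤ r (i+1) - r i := by
      intro i hi
      induction i, hi using Nat.le_induction with
      | base => simp [h1, h2]
      | succ n hn ih => have := h3 n hn; rw [show n + 1 + 1 = n + 2 from rfl]; omega
    have hp : ∀ i, 1 ≤ i → 1 ≤ r i := by
      intro i hi
      induction i, hi using Nat.le_induction with
      | base => simp [h1]
      | succ n hn ih => have := hd n hn; omega
    intro i hi
    have := hd i hi
    have := hp i hi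
    unfold aseq
    omega
  have hR : ∀ i, Rmat r i = ((Real.sqrt 5 / 2) * ((3 - Real.sqrt 5)/2) ^ (aseq r (i+1))) •
      (Amat ^ (aseq r i) * Mmat * Amat ^ (aseq r (i+1)) * Mmat) := by
    intro i
    unfold Rmat Pmat cseq
    congr 1
    rw [pow_mul, hgp, mul_inv, inv_div, ← inv_pow]
    congr 2
    apply inv_eq_of_mul_eq_one_right
    nlinarith
  have hpow := Amat_pow (Real.sqrt 5) hs
  have hfix := Amat_fix (Real.sqrt 5)
  generalize Real.sqrt 5 = s at *
  set p : ℝ := (3 + s)/2 with hp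
  set q : ℝ := (3 - s)/2 with hq
  have hpq : q * p = 1 := by rw [hp, hq]; nlinarith
  have hq0 : 0 < q := by rw [hq]; linarith
  have hq1 : q < 1 := by rw [hq]; linarith
  have hp1 : 1 ≤ p := by rw [hp]; linarith
  set U := vecMulVec (uvec s) (wvec s) with hU
  set V := vecMulVec (uvec (-s)) (wvec (-s)) with hV
  set V' := (-(s/5)) • V with hV'
  set K1 := frobNorm Eone + (s/5) * frobNorm U + frobNorm V' with hK1
  have nE := frobNorm_nonneg Eone
  have nU := frobNorm_nonneg U
  have nV := frobNorm_nonneg V'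
  have nM := frobNorm_nonneg Mmat
  have hK10 : 0 ≤ K1 := by positivity
  have hpow' : ∀ n, Amat ^ n = Eone + (p^n * (s/5)) • U + (q^n) • V' := by
    intro n; rw [hpow, hV', smul_smul]
  have hA : ∀ n, frobNorm (Amat ^ n) ≤ K1 * p ^ n := by
    intro n
    have hpn : 1 ≤ p ^ n := one_le_pow₀ hp1
    have hqn : q ^ n ≤ 1 := pow_le_one₀ hq0.le hq1.le
    rw [hpow']
    refine (frobNorm_add_le _ _).trans ?_
    refine (add_le_add_left (frobNorm_add_le _ _) _).trans ?_
    rw [frobNorm_smul _ (by positivity), frobNorm_smul _ (by positivity), hK1]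
    nlinarith
  have hrem : ∀ n, (s/2 * q^n) • Amat ^ n
      = ((1:ℝ)/2) • U + (s/2 * q^n) • (Eone + (q^n) • V') := by
    intro n
    have hqp : q ^ n * p ^ n = 1 := by rw [← mul_pow, hpq, one_pow]
    rw [hpow', add_right_comm, smul_add, add_comm, smul_smul]
    congr 2
    linear_combination (s * s / 10) * hqp + hs / 10
  have hE : ∀ i, Rmat r i - Lmat = (s/2 * q^(aseq r (i+1))) •
      (Amat ^ (aseq r i) * Mmat * (Eone + (q^(aseq r (i+1))) • V') * Mmat) := by
    intro i
    have e1 : Rmat r i = Amat ^ (aseq r i) * Mmat * ((s/2 * q^(aseq r (i+1))) •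
        Amat ^ (aseq r (i+1))) * Mmat := by
      rw [hR, Matrix.mul_smul, Matrix.smul_mul]
    rw [e1, hrem, Matrix.mul_add, Matrix.add_mul, Matrix.mul_smul, Matrix.mul_smul,
      Matrix.mul_assoc (Amat ^ (aseq r i)) Mmat U, hfix, hL, Matrix.smul_mul, Matrix.smul_mul,
      add_sub_cancel_left]
  refine ⟨(s/2) * K1 * frobNorm Mmat * (frobNorm Eone + frobNorm V') * frobNorm Mmat + 1, q,
    by positivity, hq0.le, hq1, ?_⟩
  intro i hi
  rw [hE, frobNorm_smul _ (by positivity)]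
  set a := aseq r i
  set b := aseq r (i+1)
  have hab : a + i ≤ b := hgap i hi
  have hqb : q ^ b ≤ 1 := pow_le_one₀ hq0.le hq1.le
  have b1 : frobNorm (Eone + (q^b) • V') ≤ frobNorm Eone + frobNorm V' := by
    refine (frobNorm_add_le _ _).trans ?_
    rw [frobNorm_smul _ (by positivity)]
    nlinarith
  have b2 : frobNorm (Amat ^ a * Mmat * (Eone + (q^b) • V') * Mmat)
      ≤ K1 * p ^ a * frobNorm Mmat * (frobNorm Eone + frobNorm V') * frobNorm Mmat := by
    refine (frobNorm_mul_le _ _).trans (mul_le_mul_of_nonneg_right ?_ nM)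
    refine (frobNorm_mul_le _ _).trans (mul_le_mul ?_ b1 (frobNorm_nonneg _) (by positivity))
    exact (frobNorm_mul_le _ _).trans (mul_le_mul_of_nonneg_right (hA a) nM)
  have b3 : q ^ b * p ^ a ≤ q ^ i := by
    obtain ⟨d, hd⟩ := Nat.exists_eq_add_of_le hab
    have : q ^ b * p ^ a = q ^ i * q ^ d := by
      have hqp : q ^ a * p ^ a = 1 := by rw [← mul_pow, hpq, one_pow]
      rw [hd, pow_add, pow_add]
      linear_combination q ^ i * q ^ d * hqp
    rw [this]
    exact mul_le_of_le_one_right (by positivity) (pow_le_one₀ hq0.le hq1.le)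
  set N := K1 * frobNorm Mmat * (frobNorm Eone + frobNorm V') * frobNorm Mmat with hN
  have hN0 : 0 ≤ N := by positivity
  calc _ ≤ s / 2 * q ^ b *
        (K1 * p ^ a * frobNorm Mmat * (frobNorm Eone + frobNorm V') * frobNorm Mmat) :=
        mul_le_mul_of_nonneg_left b2 (by positivity)
    _ = s / 2 * N * (q ^ b * p ^ a) := by rw [hN]; ring
    _ ≤ s / 2 * N * q ^ i := mul_le_mul_of_nonneg_left b3 (by positivity)
    _ ≤ s / 2 * N * q ^ i + q ^ i := le_add_of_nonneg_right (by positivity)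
    _ = _ := by rw [hN]; ring

/-- `‖R_i R_{i+2} ⋯ R_{i+2k} − (L + (R_i − L)·L)‖_F ≤ C (exp(∑_{l=1}^k ‖R_{i+2l} − L‖_F) − 1)`. -/
theorem stmt5 (r : ℕ → ℕ) (hr : GoodSeq r) :
    ∃ C : ℝ, 0 < C ∧ ∀ i : ℕ, 1 ≤ i → ∀ k : ℕ, 1 ≤ k →
      frobNorm (((List.range (k+1)).map (fun l => Rmat r (i + 2*l))).prod
          - (Lmat + (Rmat r i - Lmat) * Lmat))
        ≤ C * (Real.exp (∑ l ∈ Finset.Icc 1 k, frobNorm (Rmat r (i + 2*l) - Lmat)) - 1) := by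
  obtain ⟨K, q, hK, hq0, hq1, hb⟩ := exists_geom_bound r hr
  have hq1' : 0 < 1 - q := by linarith
  obtain ⟨C, hC, hmain⟩ := product_estimate Lmat Lmat_sq (K * (1 - q)⁻¹) (frobNorm Lmat + K)
    (by have := frobNorm_nonneg Lmat; linarith)
  refine ⟨C, hC, ?_⟩
  intro i hi k hk
  have h := hmain (fun l => Rmat r (i + 2*l)) ?_ ?_ k
  · rw [if_neg (by omega), add_zero] at h
    exact h
  · have e : Rmat r (i + 2*0) = Lmat + (Rmat r i - Lmat) := by simp
    simp only [e]
    refine (frobNorm_add_le _ _).trans ?_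
    have h1 := hb i hi
    have h2 : q ^ i ≤ 1 := pow_le_one₀ hq0 hq1.le
    nlinarith
  · intro m
    calc ∑ l ∈ Finset.Icc 1 m, frobNorm (Rmat r (i + 2*l) - Lmat)
        ≤ ∑ l ∈ Finset.Icc 1 m, K * q ^ l := by
          apply Finset.sum_le_sum
          intro l _
          refine (hb _ (by omega)).trans ?_
          apply mul_le_mul_of_nonneg_left _ hK.le
          exact pow_le_pow_of_le_one hq0 hq1.le (by omega)
      _ = K * ∑ l ∈ Finset.Icc 1 m, q ^ l := by rw [Finset.mul_sum]
      _ ≤ K * (1 - q)⁻¹ := by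
          apply mul_le_mul_of_nonneg_left _ hK.le
          rw [← tsum_geometric_of_lt_one hq0 hq1]
          exact (summable_geometric_of_lt_one hq0 hq1).sum_le_tsum _ (fun _ _ => by positivity)
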